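/- (Meyer's theorem, special case used in the paper) Every nondegenerate integral quadratic form in at least 5 variables that is indefinite over ℝ represents zero nontrivially over ℤ: there exists a nonzero integer vector x with q(x) = 0. -/

import Mathlib

set_option linter.all false

/-- unit part of `a` at `p` -/
def mUp (p : ℕ) (a : ℤ) : ℤ := a / (p : ℤ) ^ padicValInt p a

/-- parity of the valuation -/
def mVal (p : ℕ) (a : ℤ) : ZMod 2 := (padicValInt p a : ZMod 2)

open Classical in
/-- quadratic character of the unit part -/
noncomputable def mChi (p : ℕ) (a : ℤ) : ZMod 2 :=
  if IsSquare ((mUp p a : ℤ) : ZMod p) then 0 else 1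

def mE (a : ℤ) : ZMod 2 := if mUp 2 a % 4 = 1 then 0 else 1

def mW (a : ℤ) : ZMod 2 := if mUp 2 a % 8 = 1 ∨ mUp 2 a % 8 = 7 then 0 else 1

def mSg (a : ℤ) : ZMod 2 := if a < 0 then 1 else 0

/-- odd Hilbert symbol -/
noncomputable def mH (p : ℕ) (a b : ℤ) : ZMod 2 :=
  mChi p (-1) * mVal p a * mVal p b + mChi p a * mVal p b + mChi p b * mVal p a

def mH2 (a b : ℤ) : ZMod 2 := mE a * mE b + mVal 2 a * mW b + mVal 2 b * mW a

def mHinf (a b : ℤ) : ZMod 2 := mSg a * mSg b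

lemma mUp_spec {p : ℕ} (hp : p.Prime) {a : ℤ} (ha : a ≠ 0) :
    a = (p : ℤ) ^ padicValInt p a * mUp p a ∧ ¬ (p : ℤ) ∣ mUp p a := by
  have := Fact.mk hp
  have h1 : a = (p : ℤ) ^ padicValInt p a * mUp p a := by
    rw [mUp, Int.mul_ediv_cancel' (padicValInt_dvd a)]
  refine ⟨h1, ?_⟩
  rintro ⟨k, hk⟩
  have h2 : (p : ℤ) ^ (padicValInt p a + 1) ∣ a := ⟨k, by
    rw [pow_succ, mul_assoc, ← hk]; exact h1⟩
  rw [padicValInt_dvd_iff] at h2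
  rcases h2 with h2 | h2
  · exact ha h2
  · omega

lemma mUp_unique {p : ℕ} (hp : p.Prime) {a u : ℤ} {k : ℕ} (h : a = (p : ℤ) ^ k * u)
    (hu : ¬ (p : ℤ) ∣ u) : padicValInt p a = k ∧ mUp p a = u := by
  have := Fact.mk hp
  have hp0 : (p : ℤ) ≠ 0 := by exact_mod_cast hp.ne_zero
  have hu0 : u ≠ 0 := by rintro rfl; exact hu (dvd_zero _)
  have h1 : padicValInt p a = k := by
    have : padicValInt p ((p : ℤ) ^ k) = k := by
      have : ((p : ℤ) ^ k) = ((p ^ k : ℕ) : ℤ) := by push_cast; rfl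
      rw [this, padicValInt.of_nat, padicValNat.prime_pow]
    rw [h, padicValInt.mul (pow_ne_zero _ hp0) hu0, this, padicValInt.eq_zero_of_not_dvd hu, add_zero]
  refine ⟨h1, ?_⟩
  rw [mUp, h1, h, Int.mul_ediv_cancel_left _ (pow_ne_zero _ hp0)]

lemma mUp_mul {p : ℕ} (hp : p.Prime) {a b : ℤ} (ha : a ≠ 0) (hb : b ≠ 0) :
    padicValInt p (a * b) = padicValInt p a + padicValInt p b ∧
    mUp p (a * b) = mUp p a * mUp p b := by
  obtain ⟨h1, h2⟩ := mUp_spec hp ha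
  obtain ⟨h3, h4⟩ := mUp_spec hp hb
  apply mUp_unique hp
  · conv_lhs => rw [h1, h3]
    ring
  · intro h
    rcases (Nat.prime_iff_prime_int.mp hp).dvd_or_dvd h with h | h
    · exact h2 h
    · exact h4 h

lemma mVal_mul {p : ℕ} (hp : p.Prime) {a b : ℤ} (ha : a ≠ 0) (hb : b ≠ 0) :
    mVal p (a * b) = mVal p a + mVal p b := by
  simp only [mVal, (mUp_mul hp ha hb).1]; push_cast; rfl

lemma mUp_cast_ne {p : ℕ} (hp : p.Prime) {a : ℤ} (ha : a ≠ 0) :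
    ((mUp p a : ℤ) : ZMod p) ≠ 0 := by
  rw [Ne, ZMod.intCast_zmod_eq_zero_iff_dvd]; exact (mUp_spec hp ha).2

lemma sq_ind_mul {p : ℕ} [Fact p.Prime] (x y : ℤ) (hx : (x : ZMod p) ≠ 0) (hy : (y : ZMod p) ≠ 0) :
   IsSquare ((x * y : ℤ) : ZMod p) ↔ (IsSquare (x : ZMod p) ↔ IsSquare (y : ZMod p)) := by
  have hxy : ((x * y : ℤ) : ZMod p) ≠ 0 := by push_cast; exact mul_ne_zero hx hy
  rw [← legendreSym.eq_one_iff p hx, ← legendreSym.eq_one_iff p hy, ← legendreSym.eq_one_iff p hxy,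
    legendreSym.mul]
  rcases legendreSym.eq_one_or_neg_one p hx with h | h <;>
  rcases legendreSym.eq_one_or_neg_one p hy with h' | h' <;> simp [h, h'] <;> decide

lemma mChi_mul {p : ℕ} (hp : p.Prime) {a b : ℤ} (ha : a ≠ 0) (hb : b ≠ 0) :
    mChi p (a * b) = mChi p a + mChi p b := by
  have := Fact.mk hp
  have := sq_ind_mul (p := p) (mUp p a) (mUp p b) (mUp_cast_ne hp ha) (mUp_cast_ne hp hb)
  simp only [mChi, (mUp_mul hp ha hb).2, this]
  by_cases h : IsSquare (mUp p a : ZMod p) <;> by_cases h' : IsSquare (mUp p b : ZMod p) <;>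
    simp [h, h'] <;> decide

lemma mUp_two_odd {a : ℤ} (ha : a ≠ 0) : mUp 2 a % 8 = 1 ∨ mUp 2 a % 8 = 3 ∨
    mUp 2 a % 8 = 5 ∨ mUp 2 a % 8 = 7 := by
  have := (mUp_spec Nat.prime_two ha).2
  push_cast at this
  omega

lemma mE_mul {a b : ℤ} (ha : a ≠ 0) (hb : b ≠ 0) : mE (a * b) = mE a + mE b := by
  have e : ∀ x : ℤ, x % 4 = (x % 8) % 4 := by intro x; omega
  simp only [mE, (mUp_mul Nat.prime_two ha hb).2]
  rw [e (_ * _), e (mUp 2 a), e (mUp 2 b), Int.mul_emod]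
  rcases mUp_two_odd ha with h | h | h | h <;> rcases mUp_two_odd hb with h' | h' | h' | h' <;>
    rw [h, h'] <;> decide

lemma mW_mul {a b : ℤ} (ha : a ≠ 0) (hb : b ≠ 0) : mW (a * b) = mW a + mW b := by
  simp only [mW, (mUp_mul Nat.prime_two ha hb).2]
  rw [Int.mul_emod]
  rcases mUp_two_odd ha with h | h | h | h <;> rcases mUp_two_odd hb with h' | h' | h' | h' <;>
    rw [h, h'] <;> decide

lemma mSg_mul {a b : ℤ} (ha : a ≠ 0) (hb : b ≠ 0) : mSg (a * b) = mSg a + mSg b := by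
  simp only [mSg]
  rcases lt_or_gt_of_ne ha with h | h <;> rcases lt_or_gt_of_ne hb with h' | h'
  · simp [h, h', not_lt.mpr (mul_pos_of_neg_of_neg h h').le]; decide
  · simp [h, not_lt.mpr h'.le, mul_neg_of_neg_of_pos h h']
  · simp [h', not_lt.mpr h.le, mul_neg_of_pos_of_neg h h']
  · simp [not_lt.mpr h'.le, not_lt.mpr h.le, not_lt.mpr (mul_pos h h').le]

lemma z2_add_self (x : ZMod 2) : x + x = 0 := by revert x; decide

lemma mH_mul_left {p : ℕ} (hp : p.Prime) {a b c : ℤ} (ha : a ≠ 0) (hb : b ≠ 0) :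
    mH p (a * b) c = mH p a c + mH p b c := by
  simp only [mH, mVal_mul hp ha hb, mChi_mul hp ha hb]; ring

lemma mH_comm (p : ℕ) (a b : ℤ) : mH p a b = mH p b a := by simp only [mH]; ring

lemma mH2_comm (a b : ℤ) : mH2 a b = mH2 b a := by simp only [mH2]; ring

lemma mHinf_comm (a b : ℤ) : mHinf a b = mHinf b a := by simp only [mHinf]; ring

lemma mH2_mul_left {a b c : ℤ} (ha : a ≠ 0) (hb : b ≠ 0) :
    mH2 (a * b) c = mH2 a c + mH2 b c := by
  simp only [mH2, mVal_mul Nat.prime_two ha hb, mE_mul ha hb, mW_mul ha hb]; ring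

lemma mHinf_mul_left {a b c : ℤ} (ha : a ≠ 0) (hb : b ≠ 0) :
    mHinf (a * b) c = mHinf a c + mHinf b c := by
  simp only [mHinf, mSg_mul ha hb]; ring

lemma mUp_of_not_dvd {p : ℕ} (hp : p.Prime) {a : ℤ} (h : ¬ (p : ℤ) ∣ a) :
    padicValInt p a = 0 ∧ mUp p a = a := mUp_unique hp (by simp) h

lemma mVal_of_not_dvd {p : ℕ} (hp : p.Prime) {a : ℤ} (h : ¬ (p : ℤ) ∣ a) : mVal p a = 0 := by
  simp [mVal, (mUp_of_not_dvd hp h).1]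

lemma mUp_self {p : ℕ} (hp : p.Prime) : padicValInt p p = 1 ∧ mUp p p = 1 :=
  mUp_unique hp (by simp) (by
    intro h; have := Int.eq_one_of_dvd_one (by positivity) h
    exact hp.one_lt.ne' (by exact_mod_cast this))

lemma mVal_self {p : ℕ} (hp : p.Prime) : mVal p p = 1 := by simp [mVal, (mUp_self hp).1]

lemma mChi_self {p : ℕ} (hp : p.Prime) : mChi p p = 0 := by simp [mChi, (mUp_self hp).2]

lemma not_dvd_neg_one {p : ℕ} (hp : p.Prime) : ¬ (p : ℤ) ∣ -1 := by
  rw [dvd_neg]; intro h; have := Int.eq_one_of_dvd_one (by positivity) h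
  exact hp.one_lt.ne' (by exact_mod_cast this)

lemma mVal_neg_one {p : ℕ} (hp : p.Prime) : mVal p (-1) = 0 :=
  mVal_of_not_dvd hp (not_dvd_neg_one hp)

lemma not_dvd_prime {p q : ℕ} (hp : p.Prime) (hq : q.Prime) (h : p ≠ q) : ¬ (p : ℤ) ∣ (q : ℤ) := by
  intro h'; exact h ((Nat.prime_dvd_prime_iff_eq hp hq).mp (by exact_mod_cast h'))

lemma mVal_prime {p q : ℕ} (hp : p.Prime) (hq : q.Prime) : mVal p q = if p = q then 1 else 0 := by
  split_ifs with h
  · subst h; exact mVal_self hp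
  · exact mVal_of_not_dvd hp (not_dvd_prime hp hq h)

/-- vanishing of an additive function checked on generators -/
lemma gen_induction (F : ℤ → ZMod 2) (hF : ∀ a b : ℤ, a ≠ 0 → b ≠ 0 → F (a * b) = F a + F b)
    (h1 : F (-1) = 0) (a : ℤ) (ha : a ≠ 0)
    (hq : ∀ q : ℕ, q.Prime → (q : ℤ) ∣ a → F q = 0) : F a = 0 := by
  have h11 : F 1 = 0 := by have := hF 1 1 one_ne_zero one_ne_zero; simpa using this
  have key : ∀ n : ℕ, n ≠ 0 → (∀ q : ℕ, q.Prime → q ∣ n → F q = 0) → F n = 0 := by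
    intro n
    induction n using induction_on_primes with
    | zero => simp
    | one => intro _ _; simpa using h11
    | prime_mul p n hp ih =>
      intro hn hq
      have hn' : n ≠ 0 := by rintro rfl; simp at hn
      push_cast
      rw [hF _ _ (by exact_mod_cast hp.ne_zero) (by exact_mod_cast hn'), hq p hp (dvd_mul_right _ _),
        ih hn' (fun q h h' => hq q h (Dvd.dvd.mul_left h' _)), add_zero]
  have hk := key a.natAbs (by simpa using ha) (fun q h h' => hq q h (by
    exact Int.natCast_dvd.mpr h'))
  rcases Int.natAbs_eq a with h | h
  · rw [h]; exact hk
  · rw [h, ← neg_one_mul, hF _ _ (by norm_num) (by simpa using ha), h1, hk, add_zero]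

lemma mChi_eq_legendre {p : ℕ} [hp : Fact p.Prime] {a : ℤ} (h : ¬ (p : ℤ) ∣ a) :
    (legendreSym p a = 1 ∧ mChi p a = 0) ∨ (legendreSym p a = -1 ∧ mChi p a = 1) := by
  have h0 : (a : ZMod p) ≠ 0 := by rwa [Ne, ZMod.intCast_zmod_eq_zero_iff_dvd]
  simp only [mChi, (mUp_of_not_dvd hp.out h).2]
  rcases legendreSym.eq_one_or_neg_one p h0 with h1 | h1
  · left; rw [h1]; rw [legendreSym.eq_one_iff p h0] at h1; simp [h1]
  · right; rw [h1]; rw [legendreSym.eq_neg_one_iff p] at h1; simp [h1]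

lemma prime_mod8 {p : ℕ} (hp : p.Prime) (h2 : p ≠ 2) : p % 8 = 1 ∨ p % 8 = 3 ∨ p % 8 = 5 ∨ p % 8 = 7 := by
  have := hp.eq_two_or_odd
  omega

lemma two_not_dvd {p : ℕ} (hp : p.Prime) (h2 : p ≠ 2) : ¬ ((2 : ℕ) : ℤ) ∣ (p : ℤ) :=
  not_dvd_prime Nat.prime_two hp (Ne.symm h2)

lemma mE_prime {p : ℕ} (hp : p.Prime) (h2 : p ≠ 2) : mE p = if p % 4 = 1 then 0 else 1 := by
  simp only [mE, (mUp_of_not_dvd Nat.prime_two (two_not_dvd hp h2)).2]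
  congr 1
  apply propext; omega

lemma mW_prime {p : ℕ} (hp : p.Prime) (h2 : p ≠ 2) :
    mW p = if p % 8 = 1 ∨ p % 8 = 7 then 0 else 1 := by
  simp only [mW, (mUp_of_not_dvd Nat.prime_two (two_not_dvd hp h2)).2]
  congr 1
  apply propext; omega

lemma mE_neg_one : mE (-1) = 1 := by
  simp only [mE, (mUp_of_not_dvd Nat.prime_two (not_dvd_neg_one Nat.prime_two)).2]; decide

lemma mW_neg_one : mW (-1) = 0 := by
  simp only [mW, (mUp_of_not_dvd Nat.prime_two (not_dvd_neg_one Nat.prime_two)).2]; decide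

lemma mE_two : mE ((2 : ℕ) : ℤ) = 0 := by
  simp only [mE, (mUp_self Nat.prime_two).2]; decide

lemma mW_two : mW ((2 : ℕ) : ℤ) = 0 := by
  simp only [mW, (mUp_self Nat.prime_two).2]; decide

lemma mChi_neg_one {p : ℕ} (hp : p.Prime) (h2 : p ≠ 2) : mChi p (-1) = mE p := by
  have := Fact.mk hp
  rw [mE_prime hp h2, mChi, (mUp_of_not_dvd hp (not_dvd_neg_one hp)).2]
  have := ZMod.exists_sq_eq_neg_one_iff (p := p)
  push_cast
  simp only [this]
  congr 1
  apply propext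
  have := prime_mod8 hp h2
  omega

lemma mChi_two {p : ℕ} (hp : p.Prime) (h2 : p ≠ 2) : mChi p ((2 : ℕ) : ℤ) = mW p := by
  have := Fact.mk hp
  rw [mW_prime hp h2, mChi, (mUp_of_not_dvd hp (not_dvd_prime hp Nat.prime_two h2)).2]
  have := ZMod.exists_sq_eq_two_iff (p := p) h2
  push_cast
  simp only [this]

lemma mChi_recip {p q : ℕ} (hp : p.Prime) (h2 : p ≠ 2) (hq : q.Prime) (hq2 : q ≠ 2) (hpq : p ≠ q) :
    mChi p q + mChi q p = mE p * mE q := by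
  have := Fact.mk hp
  have := Fact.mk hq
  have hr := legendreSym.quadratic_reciprocity (p := p) (q := q) h2 hq2 hpq
  rw [mE_prime hp h2, mE_prime hq hq2]
  have hm : ((-1 : ℤ)) ^ (p / 2 * (q / 2)) = if p % 4 = 1 ∨ q % 4 = 1 then 1 else -1 := by
    have := prime_mod8 hp h2
    have := prime_mod8 hq hq2
    split_ifs with h
    · apply Even.neg_one_pow
      rw [Nat.even_mul, Nat.even_iff, Nat.even_iff]; omega
    · apply Odd.neg_one_pow
      rw [Nat.odd_mul, Nat.odd_iff, Nat.odd_iff]; omega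
  rw [hm] at hr
  rcases mChi_eq_legendre (not_dvd_prime hp hq hpq) with ⟨h1, h3⟩ | ⟨h1, h3⟩ <;>
  rcases mChi_eq_legendre (not_dvd_prime hq hp hpq.symm) with ⟨h4, h5⟩ | ⟨h4, h5⟩ <;>
  rw [h1, h4] at hr <;> rw [h3, h5] <;>
  by_cases a1 : p % 4 = 1 <;> by_cases a2 : q % 4 = 1 <;> simp [a1, a2] at hr ⊢ <;> decide

noncomputable def mG (T : Finset ℕ) (a b : ℤ) : ZMod 2 := ∑ p ∈ T, mH p a b + mH2 a b + mHinf a b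

lemma mG_mul_left {T : Finset ℕ} (hT : ∀ p ∈ T, p.Prime) {a b c : ℤ} (ha : a ≠ 0) (hb : b ≠ 0) :
    mG T (a * b) c = mG T a c + mG T b c := by
  simp only [mG, mH2_mul_left ha hb, mHinf_mul_left ha hb]
  rw [Finset.sum_congr rfl (fun p hp => mH_mul_left (hT p hp) ha hb), Finset.sum_add_distrib]
  ring

lemma mG_comm (T : Finset ℕ) (a b : ℤ) : mG T a b = mG T b a := by
  simp only [mG, mH2_comm a b, mHinf_comm a b, mH_comm _ a b]

lemma mSg_nat (q : ℕ) : mSg q = 0 := by simp [mSg]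

lemma mSg_neg_one : mSg (-1) = 1 := by simp [mSg]

lemma mG_neg_one_neg_one {T : Finset ℕ} (hT : ∀ p ∈ T, p.Prime) : mG T (-1) (-1) = 0 := by
  have : ∑ p ∈ T, mH p (-1) (-1) = 0 := Finset.sum_eq_zero (fun p hp => by
    simp [mH, mVal_neg_one (hT p hp)])
  simp only [mG, this, mH2, mHinf, mSg_neg_one, mE_neg_one, mW_neg_one]; decide

lemma mG_neg_one_prime {T : Finset ℕ} (hT : ∀ p ∈ T, p.Prime ∧ p ≠ 2) {q : ℕ} (hq : q.Prime)
    (hqT : q ≠ 2 → q ∈ T) : mG T (-1) q = 0 := by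
  have h1 : ∀ p ∈ T, mH p (-1) q = if p = q then mE q else 0 := fun p hp => by
    obtain ⟨h, h'⟩ := hT p hp
    simp only [mH, mVal_neg_one h, mVal_prime h hq, mChi_neg_one h h']
    split_ifs with hh
    · subst hh; ring
    · ring
  rw [mG, Finset.sum_congr rfl h1, Finset.sum_ite_eq']
  by_cases h2 : q = 2
  · subst h2
    have : 2 ∉ T := fun h => (hT 2 h).2 rfl
    simp [this, mH2, mHinf, mSg_nat, mE_two, mW_neg_one, mVal_neg_one Nat.prime_two]
    have := mE_two
    push_cast at this
    have h3 := mSg_nat 2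
    push_cast at h3
    simp [this, h3]
  · simp only [hqT h2, if_true, mH2, mHinf, mSg_nat, mE_neg_one, mW_neg_one,
      mVal_neg_one Nat.prime_two, mul_zero, one_mul, zero_mul, add_zero, z2_add_self]

lemma mG_prime_prime {T : Finset ℕ} (hT : ∀ p ∈ T, p.Prime ∧ p ≠ 2) {q r : ℕ} (hq : q.Prime)
    (hqT : q ≠ 2 → q ∈ T) (hr : r.Prime) (hrT : r ≠ 2 → r ∈ T) : mG T q r = 0 := by
  have h1 : ∀ p ∈ T, mH p q r = (if p = q then (if p = r then mE q else 0) else 0) +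
      (if p = q then mChi q r else 0) + (if p = r then mChi r q else 0) := fun p hp => by
    obtain ⟨h, h'⟩ := hT p hp
    simp only [mH, mVal_prime h hq, mVal_prime h hr, mChi_neg_one h h']
    by_cases e1 : p = q <;> by_cases e2 : p = r
    · subst e1; subst e2; simp
    · subst e1; simp [e2]
    · subst e2; simp [e1]
    · simp [e1, e2]
  have n2 : 2 ∉ T := fun h => (hT 2 h).2 rfl
  rw [mG, Finset.sum_congr rfl h1, Finset.sum_add_distrib, Finset.sum_add_distrib,
    Finset.sum_ite_eq', Finset.sum_ite_eq', Finset.sum_ite_eq']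
  simp only [mH2, mHinf, mSg_nat, mVal_prime Nat.prime_two hq, mVal_prime Nat.prime_two hr]
  by_cases e1 : q = 2 <;> by_cases e2 : r = 2
  · subst e1; subst e2; simp only [n2, mE_two, mW_two]; simp
  · subst e1; simp only [n2, mE_two, hrT e2, mChi_two hr e2]; simp [e2, Ne.symm e2, z2_add_self]
  · subst e2; simp only [n2, mE_two, hqT e1, mChi_two hq e1]; simp [e1, Ne.symm e1, z2_add_self]
  · simp only [hqT e1, hrT e2, Ne.symm e1, Ne.symm e2, if_true, if_false]
    by_cases e : q = r
    · subst e; simp only [if_true, mChi_self hq]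
      generalize mE q = x; generalize mW q = y; revert x y; decide
    · simp only [e, if_false]
      have := mChi_recip hq e1 hr e2 e
      rw [zero_add, this]; simp [z2_add_self]

/-- product formula -/
lemma mG_eq_zero {T : Finset ℕ} (hT : ∀ p ∈ T, p.Prime ∧ p ≠ 2) {a b : ℤ} (ha : a ≠ 0) (hb : b ≠ 0)
    (haT : ∀ p : ℕ, p.Prime → p ≠ 2 → (p : ℤ) ∣ a → p ∈ T)
    (hbT : ∀ p : ℕ, p.Prime → p ≠ 2 → (p : ℤ) ∣ b → p ∈ T) : mG T a b = 0 := by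
  have hT' : ∀ p ∈ T, p.Prime := fun p hp => (hT p hp).1
  refine gen_induction (fun x => mG T x b) (fun x y hx hy => mG_mul_left hT' hx hy) ?_ a ha ?_
  · rw [mG_comm]
    refine gen_induction (fun x => mG T x (-1)) (fun x y hx hy => mG_mul_left hT' hx hy) ?_ b hb ?_
    · exact mG_neg_one_neg_one hT'
    · intro q hq hqb
      rw [mG_comm]
      exact mG_neg_one_prime hT hq (fun h => hbT q hq h hqb)
  · intro q hq hqa
    rw [mG_comm]
    refine gen_induction (fun x => mG T x q) (fun x y hx hy => mG_mul_left hT' hx hy) ?_ b hb ?_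
    · exact mG_neg_one_prime hT hq (fun h => haT q hq h hqa)
    · intro r hr hrb
      exact mG_prime_prime hT hr (fun h => hbT r hr h hrb) hq (fun h => haT q hq h hqa)

lemma mChi_congr {p : ℕ} {a b : ℤ} (h : ((mUp p a : ℤ) : ZMod p) = ((mUp p b : ℤ) : ZMod p)) :
    mChi p a = mChi p b := by
  have h' : IsSquare ((mUp p a : ℤ) : ZMod p) ↔ IsSquare ((mUp p b : ℤ) : ZMod p) := by rw [h]
  unfold mChi
  by_cases hs : IsSquare ((mUp p a : ℤ) : ZMod p)
  · rw [if_pos hs, if_pos (h'.mp hs)]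
  · rw [if_neg hs, if_neg (fun h => hs (h'.mpr h))]

lemma mVal_sq {p : ℕ} (hp : p.Prime) {t : ℤ} (ht : t ≠ 0) : mVal p (t ^ 2) = 0 := by
  rw [sq, mVal_mul hp ht ht, z2_add_self]

lemma mChi_sq {p : ℕ} (hp : p.Prime) {t : ℤ} (ht : t ≠ 0) : mChi p (t ^ 2) = 0 := by
  rw [sq, mChi_mul hp ht ht, z2_add_self]

lemma mUp_neg {p : ℕ} (hp : p.Prime) {a : ℤ} (ha : a ≠ 0) : mUp p (-a) = - mUp p a := by
  obtain ⟨h1, h2⟩ := mUp_spec hp ha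
  refine (mUp_unique hp (k := padicValInt p a) ?_ ?_).2
  · rw [mul_neg, ← h1]
  · rwa [dvd_neg]

lemma steinberg_lt {p : ℕ} (hp : p.Prime) {a b t : ℤ} (ha : a ≠ 0) (hb : b ≠ 0)
    (h : t ^ 2 = a + b) (hlt : padicValInt p a < padicValInt p b) : mH p a b = 0 := by
  obtain ⟨h1, h2⟩ := mUp_spec hp ha
  obtain ⟨h3, h4⟩ := mUp_spec hp hb
  obtain ⟨k, hk⟩ := Nat.exists_eq_add_of_lt hlt
  have hs : a + b = (p : ℤ) ^ padicValInt p a * (mUp p a + p * (p ^ k * mUp p b)) := by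
    conv_lhs => rw [h1, h3, hk]
    ring
  have hnd : ¬ (p : ℤ) ∣ (mUp p a + p * (p ^ k * mUp p b)) := by
    rwa [dvd_add_left (dvd_mul_right _ _)]
  have ht : t ≠ 0 := by
    rintro rfl
    have : (p : ℤ) ^ padicValInt p a * (mUp p a + p * (p ^ k * mUp p b)) = 0 := by
      rw [← hs, ← h]; ring
    rcases mul_eq_zero.mp this with h | h
    · exact pow_ne_zero _ (by exact_mod_cast hp.ne_zero) h
    · rw [h] at hnd; exact hnd (dvd_zero _)
  obtain ⟨h5, h6⟩ := mUp_unique hp hs hnd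
  have e1 : mVal p a = 0 := by
    have := mVal_sq hp ht
    rwa [h, mVal, h5] at this
  have e2 : mChi p a = 0 := by
    have := mChi_sq hp ht
    rw [h] at this
    rw [← this]
    apply mChi_congr
    rw [h6]; push_cast; simp
  simp [mH, e1, e2]

lemma steinberg {p : ℕ} (hp : p.Prime) {a b t : ℤ} (ha : a ≠ 0) (hb : b ≠ 0)
    (h : t ^ 2 = a + b) : mH p a b = 0 := by
  rcases lt_trichotomy (padicValInt p a) (padicValInt p b) with hlt | heq | hgt
  · exact steinberg_lt hp ha hb h hlt
  · obtain ⟨h1, h2⟩ := mUp_spec hp ha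
    obtain ⟨h3, h4⟩ := mUp_spec hp hb
    have hs : a + b = (p : ℤ) ^ padicValInt p a * (mUp p a + mUp p b) := by
      conv_lhs => rw [h1, h3, ← heq]
      ring
    have hv : mVal p b = mVal p a := by simp [mVal, heq]
    by_cases hd : (p : ℤ) ∣ (mUp p a + mUp p b)
    · have : mChi p b = mChi p (-1) + mChi p a := by
        rw [← mChi_mul hp (by norm_num) ha]
        apply mChi_congr
        rw [neg_one_mul, mUp_neg hp ha]
        rw [← ZMod.intCast_zmod_eq_zero_iff_dvd] at hd
        push_cast at hd ⊢
        linear_combination hd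
      rw [mH, this, hv]
      generalize mVal p a = x; generalize mChi p a = y; generalize mChi p (-1) = z
      revert x y z; decide
    · have ht : t ≠ 0 := by
        rintro rfl
        have h0 : (p : ℤ) ^ padicValInt p a * (mUp p a + mUp p b) = 0 := by
          rw [← hs, ← h]; ring
        rcases mul_eq_zero.mp h0 with h | h
        · exact pow_ne_zero _ (by exact_mod_cast hp.ne_zero) h
        · rw [h] at hd; exact hd (dvd_zero _)
      obtain ⟨h5, h6⟩ := mUp_unique hp hs hd
      have e1 : mVal p a = 0 := by
        have := mVal_sq hp ht
        rwa [h, mVal, h5] at this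
      simp [mH, hv, e1]
  · rw [mH_comm]
    exact steinberg_lt hp hb ha (by rw [h]; ring) hgt

lemma sqrt_mod_squarefree (a : ℤ) (n : ℕ) (hn : Squarefree n)
    (h : ∀ p : ℕ, p.Prime → p ∣ n → ∃ t : ℤ, (p : ℤ) ∣ t ^ 2 - a) :
    ∃ t : ℤ, (n : ℤ) ∣ t ^ 2 - a := by
  induction n using induction_on_primes with
  | zero => simp at hn
  | one => exact ⟨0, by simp⟩
  | prime_mul p n hp ih =>
    obtain ⟨s, hs⟩ := h p hp (dvd_mul_right _ _)
    obtain ⟨t, ht⟩ := ih (hn.of_mul_right) (fun q hq hqn => h q hq (Dvd.dvd.mul_left hqn _))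
    have hc : Nat.Coprime p n := Nat.coprime_of_squarefree_mul hn
    have hc' : IsCoprime (p : ℤ) (n : ℤ) := Nat.isCoprime_iff_coprime.mpr hc
    obtain ⟨x, y, hxy⟩ := id hc'
    refine ⟨s * (y * n) + t * (x * p), ?_⟩
    push_cast
    apply hc'.mul_dvd
    · obtain ⟨k, hk⟩ := hs
      have : (s * (y * n) + t * (x * p)) - s = p * (x * (t - s)) := by
        linear_combination s * hxy
      have e : (s * (y * n) + t * (x * p)) ^ 2 - a =
        ((s * (y * n) + t * (x * p)) - s) * ((s * (y * n) + t * (x * p)) + s) + (s ^ 2 - a) := by ring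
      rw [e, this, hk]
      exact dvd_add (Dvd.dvd.mul_right (dvd_mul_right _ _) _) (dvd_mul_right _ _)
    · obtain ⟨k, hk⟩ := ht
      have : (s * (y * n) + t * (x * p)) - t = n * (y * (s - t)) := by
        linear_combination t * hxy
      have e : (s * (y * n) + t * (x * p)) ^ 2 - a =
        ((s * (y * n) + t * (x * p)) - t) * ((s * (y * n) + t * (x * p)) + t) + (t ^ 2 - a) := by ring
      rw [e, this, hk]
      exact dvd_add (Dvd.dvd.mul_right (dvd_mul_right _ _) _) (dvd_mul_right _ _)

def mIso (a b : ℤ) : Prop := ∃ x y z : ℤ, (x ≠ 0 ∨ y ≠ 0 ∨ z ≠ 0) ∧ a * x ^ 2 + b * y ^ 2 = z ^ 2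

lemma mIso_comm {a b : ℤ} (h : mIso a b) : mIso b a := by
  obtain ⟨x, y, z, h1, h2⟩ := h
  exact ⟨y, x, z, by tauto, by linarith⟩

lemma balanced (t b : ℤ) (hb : b ≠ 0) : ∃ s : ℤ, b ∣ s - t ∧ 2 * |s| ≤ |b| := by
  have hn : 0 < b.natAbs := by positivity
  refine ⟨t.bmod b.natAbs, ?_, ?_⟩
  · have : (b.natAbs : ℤ) ∣ t.bmod b.natAbs - t := by
      have := Int.bmod_emod (x := t) (m := b.natAbs)
      exact Int.ModEq.dvd (show t ≡ t.bmod b.natAbs [ZMOD b.natAbs] from this.symm)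
    exact Int.natAbs_dvd.mp this
  · have h1 := Int.le_bmod (x := t) (m := b.natAbs) hn
    have h2 := Int.bmod_lt (x := t) (m := b.natAbs) hn
    rw [Int.abs_eq_natAbs b]
    rcases abs_cases (t.bmod b.natAbs) with h | h <;> omega

/-- Legendre's theorem, by descent -/
theorem legendre_descent : ∀ (N : ℕ) (a b : ℤ), a.natAbs + b.natAbs ≤ N → a ≠ 0 → b ≠ 0 →
    (∀ p : ℕ, p.Prime → p ≠ 2 → mH p a b = 0) → (0 < a ∨ 0 < b) → mIso a b := by
  intro N
  induction N using Nat.strong_induction_on with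
  | _ N ih =>
  suffices H : ∀ (a b : ℤ), a.natAbs + b.natAbs ≤ N → a ≠ 0 → b ≠ 0 →
    (∀ p : ℕ, p.Prime → p ≠ 2 → mH p a b = 0) → (0 < a ∨ 0 < b) → a.natAbs ≤ b.natAbs → mIso a b by
    intro a b hN ha hb hH hs
    rcases le_total a.natAbs b.natAbs with h | h
    · exact H a b hN ha hb hH hs h
    · exact mIso_comm (H b a (by omega) hb ha (fun p hp h2 => by rw [mH_comm]; exact hH p hp h2)
        hs.symm h)
  intro a b hN ha hb hH hs hab
  by_cases hb1 : b.natAbs = 1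
  · have ha1 : a.natAbs = 1 := by have : a.natAbs ≠ 0 := by simpa using ha
                                  omega
    rcases hs with h | h
    · have : a = 1 := by omega
      exact ⟨1, 0, 1, by simp, by subst this; ring⟩
    · have : b = 1 := by omega
      exact ⟨0, 1, 1, by simp, by subst this; ring⟩
  have hb2 : 2 ≤ b.natAbs := by have : b.natAbs ≠ 0 := by simpa using hb
                                omega
  by_cases hsq : Squarefree b.natAbs
  swap
  · -- remove a square factor
    rw [Nat.squarefree_iff_prime_squarefree] at hsq
    push Not at hsq
    obtain ⟨k, hk, hkb⟩ := hsq
    obtain ⟨b', hb'⟩ : ((k * k : ℕ) : ℤ) ∣ b := Int.natCast_dvd.mpr hkb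
    push_cast at hb'
    have hk0 : (k : ℤ) ≠ 0 := by exact_mod_cast hk.ne_zero
    have hb'0 : b' ≠ 0 := by rintro rfl; simp at hb'; exact hb hb'
    have hlt : b'.natAbs < b.natAbs := by
      rw [hb', Int.natAbs_mul, Int.natAbs_mul, Int.natAbs_natCast]
      have h4 : 4 ≤ k * k := Nat.mul_le_mul hk.two_le hk.two_le
      have : 0 < b'.natAbs := by positivity
      nlinarith
    have := ih (a.natAbs + b'.natAbs) (by omega) a b' le_rfl ha hb'0 (fun p hp h2 => by
      have := hH p hp h2
      rw [hb', mH_comm, mH_mul_left hp (mul_ne_zero hk0 hk0) hb'0, mH_mul_left hp hk0 hk0,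
        z2_add_self, zero_add, mH_comm] at this
      exact this) (by
        rcases hs with h | h
        · exact Or.inl h
        · right
          rw [hb'] at h
          exact pos_of_mul_pos_right h (mul_self_nonneg _))
    obtain ⟨x, y, z, h1, h2⟩ := this
    refine ⟨k * x, y, k * z, ?_, ?_⟩
    · rcases h1 with h | h | h
      · left; exact mul_ne_zero hk0 h
      · right; left; exact h
      · right; right; exact mul_ne_zero hk0 h
    · rw [hb']; linear_combination (k : ℤ) ^ 2 * h2
  obtain ⟨t0, ht0⟩ := sqrt_mod_squarefree a b.natAbs hsq (by
    intro p hp hpb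
    have hpb' : (p : ℤ) ∣ b := Int.natCast_dvd.mpr hpb
    by_cases hpa : (p : ℤ) ∣ a
    · exact ⟨0, by simpa using hpa⟩
    by_cases hp2 : p = 2
    · subst hp2
      exact ⟨1, by push_cast at hpa ⊢; omega⟩
    have h0 := hH p hp hp2
    have hvb : mVal p b = 1 := by
      obtain ⟨c, hc⟩ := hpb'
      have hpc : ¬ (p : ℤ) ∣ c := by
        rintro ⟨d, hd⟩
        rw [Nat.squarefree_iff_prime_squarefree] at hsq
        apply hsq p hp
        apply Int.natCast_dvd.mp
        push_cast
        exact ⟨d, by rw [hc, hd]; ring⟩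
      rw [mVal, (mUp_unique hp (k := 1) (u := c) (by rw [pow_one]; exact hc) hpc).1]; simp
    rw [mH, hvb, mVal_of_not_dvd hp hpa] at h0
    simp [mChi, (mUp_of_not_dvd hp hpa).2] at h0
    obtain ⟨s, hs⟩ := h0
    obtain ⟨s', rfl⟩ := ZMod.intCast_surjective s
    refine ⟨s', ?_⟩
    rw [← ZMod.intCast_zmod_eq_zero_iff_dvd]
    push_cast
    rw [hs]; ring)
  rw [Int.natAbs_dvd] at ht0
  obtain ⟨t, htt, htb⟩ := balanced t0 b hb
  have htd : b ∣ t ^ 2 - a := by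
    have : t ^ 2 - a = (t - t0) * (t + t0) + (t0 ^ 2 - a) := by ring
    rw [this]; exact dvd_add (Dvd.dvd.mul_right htt _) ht0
  obtain ⟨b', hb'⟩ := htd
  by_cases hz : t ^ 2 - a = 0
  · exact ⟨1, 0, t, by simp, by linarith⟩
  have hb'0 : b' ≠ 0 := by rintro rfl; simp at hb'; exact hz hb'
  have hlt : b'.natAbs < b.natAbs := by
    have h1 : |b| * |b'| ≤ |t| ^ 2 + |a| := by
      rw [← abs_mul, ← hb', ← abs_pow]; exact abs_sub _ _
    have h2 : |a| ≤ |b| := by rw [Int.abs_eq_natAbs, Int.abs_eq_natAbs]; exact_mod_cast hab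
    have h3 : 2 ≤ |b| := by rw [Int.abs_eq_natAbs]; exact_mod_cast hb2
    have h4 : 0 ≤ |t| := abs_nonneg _
    zify
    by_contra! h5
    nlinarith
  have hiso := ih (a.natAbs + b'.natAbs) (by omega) a b' le_rfl ha hb'0 (fun p hp h2 => by
    have h1 := hH p hp h2
    have h3 := steinberg hp (a := a) (b := b * b') (t := t) ha (mul_ne_zero hb hb'0) (by
      rw [← hb']; ring)
    rw [mH_comm, mH_mul_left hp hb hb'0, mH_comm p b a, h1, zero_add, mH_comm] at h3
    exact h3) (by
      by_cases h : 0 < a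
      · exact Or.inl h
      · right
        have hbp : 0 < b := by tauto
        have : 0 < b * b' := by
          rw [← hb']
          have : a < 0 := by omega
          nlinarith [sq_nonneg t]
        exact pos_of_mul_pos_right this hbp.le)
  obtain ⟨x, y, z, h1, h2⟩ := hiso
  by_cases hy : y = 0
  · subst hy
    exact ⟨x, 0, z, h1, by linarith⟩
  · refine ⟨t * x + z, b' * y, t * z + a * x, ?_, ?_⟩
    · right; left; exact mul_ne_zero hb'0 hy
    · linear_combination (t ^ 2 - a) * h2 - b' * y ^ 2 * hb'

def bOdd (e : ZMod 2) (x y : ZMod 2 × ZMod 2) : ZMod 2 := e * x.1 * y.1 + x.2 * y.1 + y.2 * x.1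

def bTwo (x y : ZMod 2 × ZMod 2 × ZMod 2) : ZMod 2 :=
  x.2.1 * y.2.1 + x.1 * y.2.2 + y.1 * x.2.2

lemma local_abstract {V : Type} [AddCommGroup V] (h2 : ∀ x : V, x + x = 0) (B : V → V → ZMod 2)
    (m : V) (P1 : ∀ a1 a2 w : V, ∃ c, B (a1 + c) (a2 + c) = 0 ∧ c ≠ w)
    (P2 : ∀ a3 a4 c : V, c ≠ m + a3 + a4 → ∃ d, B (a3 + d) (a4 + d) = 0 ∧ B c d = 0)
    (a1 a2 a3 a4 a5 : V) :
    ∃ c d, B (a1 + c) (a2 + c) = 0 ∧ B (a3 + d) (a4 + d) = 0 ∧ B (m + a5 + c) (m + a5 + d) = 0 := by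
  obtain ⟨c, hc, hcw⟩ := P1 a1 a2 (a5 + a3 + a4)
  obtain ⟨d, hd, hd'⟩ := P2 (a3 + (m + a5)) (a4 + (m + a5)) (m + a5 + c) (by
    intro h
    apply hcw
    have e : c = a3 + a4 + (m + m) + a5 := by
      have : m + a5 + c = m + a5 + (a3 + a4 + (m + m) + a5) := by rw [h]; abel
      exact add_left_cancel this
    rw [e, h2 m]; abel)
  refine ⟨c, m + a5 + d, hc, ?_, ?_⟩
  · rw [← hd]; congr 1 <;> abel
  · have : m + a5 + (m + a5 + d) = d := by
      rw [← add_assoc, h2, zero_add]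
    rw [this, hd']

lemma local_odd (e : ZMod 2) (a1 a2 a3 a4 a5 : ZMod 2 × ZMod 2) :
    ∃ c d, bOdd e (a1 + c) (a2 + c) = 0 ∧ bOdd e (a3 + d) (a4 + d) = 0 ∧
      bOdd e ((0, e) + a5 + c) ((0, e) + a5 + d) = 0 := by
  apply local_abstract
  · decide
  · revert e; decide +kernel
  · revert e; decide +kernel

lemma local_two (a1 a2 a3 a4 a5 : ZMod 2 × ZMod 2 × ZMod 2) :
    ∃ c d, bTwo (a1 + c) (a2 + c) = 0 ∧ bTwo (a3 + d) (a4 + d) = 0 ∧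
      bTwo ((0, 1, 0) + a5 + c) ((0, 1, 0) + a5 + d) = 0 := by
  apply local_abstract
  · decide
  · decide +kernel
  · decide +kernel

lemma local_inf (s1 s2 s3 s4 s5 : ZMod 2) (h : ¬ (s1 = s2 ∧ s2 = s3 ∧ s3 = s4 ∧ s4 = s5)) :
    ∃ c d, (s1 + c) * (s2 + c) = 0 ∧ (s3 + d) * (s4 + d) = 0 ∧
      (1 + s5 + c) * (1 + s5 + d) = 0 := by
  revert s1 s2 s3 s4 s5; decide +kernel

noncomputable def clsOdd (p : ℕ) (a : ℤ) : ZMod 2 × ZMod 2 := (mVal p a, mChi p a)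

def clsTwo (a : ℤ) : ZMod 2 × ZMod 2 × ZMod 2 := (mVal 2 a, mE a, mW a)

lemma clsOdd_mul {p : ℕ} (hp : p.Prime) {a b : ℤ} (ha : a ≠ 0) (hb : b ≠ 0) :
    clsOdd p (a * b) = clsOdd p a + clsOdd p b := by
  simp [clsOdd, mVal_mul hp ha hb, mChi_mul hp ha hb]

lemma clsTwo_mul {a b : ℤ} (ha : a ≠ 0) (hb : b ≠ 0) :
    clsTwo (a * b) = clsTwo a + clsTwo b := by
  simp [clsTwo, mVal_mul Nat.prime_two ha hb, mE_mul ha hb, mW_mul ha hb]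

lemma mH_eq (p : ℕ) (a b : ℤ) : mH p a b = bOdd (mChi p (-1)) (clsOdd p a) (clsOdd p b) := rfl

lemma mH2_eq (a b : ℤ) : mH2 a b = bTwo (clsTwo a) (clsTwo b) := rfl

lemma exists_res {p : ℕ} (hp : p.Prime) (h2 : p ≠ 2) (x : ZMod 2) :
    ∃ r : ℕ, Nat.Coprime r p ∧ ∀ l : ℕ, l ≡ r [MOD p] → clsOdd p l = (0, x) := by
  have := Fact.mk hp
  have key : ∀ r : ℕ, ((r : ℕ) : ZMod p) ≠ 0 → (IsSquare ((r : ℕ) : ZMod p) ↔ x = 0) →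
      Nat.Coprime r p ∧ ∀ l : ℕ, l ≡ r [MOD p] → clsOdd p l = (0, x) := by
    intro r h0 hr
    refine ⟨?_, ?_⟩
    · rw [Nat.coprime_comm, hp.coprime_iff_not_dvd]
      rwa [Ne, ZMod.natCast_eq_zero_iff] at h0
    · intro l hl
      have hl' : ((l : ℕ) : ZMod p) = r := (ZMod.natCast_eq_natCast_iff _ _ _).mpr hl
      have hnd : ¬ (p : ℤ) ∣ (l : ℤ) := by
        rw [← ZMod.intCast_zmod_eq_zero_iff_dvd]; push_cast; rwa [hl']
      have h3 : mChi p l = x := by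
        have h4 : IsSquare ((mUp p l : ℤ) : ZMod p) ↔ x = 0 := by
          rw [(mUp_of_not_dvd hp hnd).2, ← hr]; push_cast; rw [hl']
        unfold mChi
        by_cases hx : x = 0
        · rw [if_pos (h4.mpr hx), hx]
        · rw [if_neg (fun h => hx (h4.mp h))]
          clear * - hx
          revert x; decide
      rw [clsOdd, mVal_of_not_dvd hp hnd, h3]
  by_cases hx : x = 0
  · exact ⟨1, key 1 (by simp) (by simp [hx])⟩
  · obtain ⟨a, ha⟩ := FiniteField.exists_nonsquare (F := ZMod p) (by rwa [ZMod.ringChar_zmod_n])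
    refine ⟨a.val, key _ ?_ ?_⟩
    · rw [ZMod.natCast_zmod_val]; rintro rfl; exact ha (IsSquare.zero)
    · rw [ZMod.natCast_zmod_val]; simp [ha, hx]

lemma exists_res_two (e w : ZMod 2) :
    ∃ r : ℕ, Nat.Coprime r 8 ∧ ∀ l : ℕ, l ≡ r [MOD 8] → clsTwo l = (0, e, w) := by
  have key : ∀ r : ℕ, r % 2 = 1 → r < 8 → (r % 4 = 1 ↔ e = 0) → ((r = 1 ∨ r = 7) ↔ w = 0) → 
      Nat.Coprime r 8 ∧ ∀ l : ℕ, l ≡ r [MOD 8] → clsTwo l = (0, e, w) := by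
    intro r h0 h8 h1 h2
    refine ⟨?_, ?_⟩
    · have : Nat.Coprime r (2 ^ 3) := by
        apply Nat.Coprime.pow_right
        rw [Nat.coprime_comm, Nat.prime_two.coprime_iff_not_dvd]; omega
      exact this
    · intro l hl
      have hl' : l % 8 = r := by rw [Nat.ModEq] at hl; omega
      have hnd : ¬ ((2 : ℕ) : ℤ) ∣ (l : ℤ) := by push_cast; omega
      have hE : mE l = e := by
        rw [mE, (mUp_of_not_dvd Nat.prime_two hnd).2]
        have : (l : ℤ) % 4 = 1 ↔ e = 0 := by rw [← h1]; omega
        by_cases he : e = 0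
        · rw [if_pos (this.mpr he), he]
        · rw [if_neg (fun h => he (this.mp h))]; clear * - he; revert e; decide
      have hW : mW l = w := by
        rw [mW, (mUp_of_not_dvd Nat.prime_two hnd).2]
        have : ((l : ℤ) % 8 = 1 ∨ (l : ℤ) % 8 = 7) ↔ w = 0 := by rw [← h2]; omega
        by_cases he : w = 0
        · rw [if_pos (this.mpr he), he]
        · rw [if_neg (fun h => he (this.mp h))]; clear * - he; revert w; decide
      rw [clsTwo, mVal_of_not_dvd Nat.prime_two hnd, hE, hW]
  have : (∃ r : ℕ, r % 2 = 1 ∧ r < 8 ∧ (r % 4 = 1 ↔ e = 0) ∧ ((r = 1 ∨ r = 7) ↔ w = 0)) := by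
    by_cases he : e = 0 <;> by_cases hw : w = 0
    · exact ⟨1, by simp [he, hw]⟩
    · exact ⟨5, by simp [he, hw]⟩
    · exact ⟨7, by simp [he, hw]⟩
    · exact ⟨3, by simp [he, hw]⟩
  obtain ⟨r, a, b, c, d⟩ := this
  exact ⟨r, key r a b c d⟩

lemma crt_set (T : Finset ℕ) (hT : ∀ p ∈ T, p.Prime ∧ p ≠ 2) (r : ℕ → ℕ) (r2 : ℕ)
    (hr : ∀ p ∈ T, Nat.Coprime (r p) p) (hr2 : Nat.Coprime r2 8) :
    ∃ k : ℕ, Nat.Coprime k (8 * ∏ p ∈ T, p) ∧ k ≡ r2 [MOD 8] ∧ ∀ p ∈ T, k ≡ r p [MOD p] := by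
  classical
  induction T using Finset.induction_on with
  | empty => exact ⟨r2, by simpa using hr2, Nat.ModEq.refl _, by simp⟩
  | insert q T hq ih =>
    obtain ⟨k, hk1, hk2, hk3⟩ := ih (fun p hp => hT p (Finset.mem_insert_of_mem hp))
      (fun p hp => hr p (Finset.mem_insert_of_mem hp))
    obtain ⟨hqp, hq2⟩ := hT q (Finset.mem_insert_self _ _)
    have hc : Nat.Coprime (8 * ∏ p ∈ T, p) q := by
      apply Nat.Coprime.mul_left
      · have : Nat.Coprime (2 ^ 3) q := by
          apply Nat.Coprime.pow_left
          exact (Nat.coprime_primes Nat.prime_two hqp).mpr (Ne.symm hq2)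
        exact this
      · apply Nat.Coprime.prod_left
        intro p hp
        apply (Nat.coprime_primes (hT p (Finset.mem_insert_of_mem hp)).1 hqp).mpr
        rintro rfl; exact hq hp
    obtain ⟨k', h1, h2⟩ := Nat.chineseRemainder hc k (r q)
    refine ⟨k', ?_, ?_, ?_⟩
    · rw [Finset.prod_insert hq, mul_left_comm, Nat.coprime_mul_iff_right]
      refine ⟨?_, ?_⟩
      · have := h2.gcd_eq
        rw [Nat.Coprime, this]; exact hr q (Finset.mem_insert_self _ _)
      · have := h1.gcd_eq
        rw [Nat.Coprime, this]; exact hk1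
    · exact (h1.of_dvd (dvd_mul_right _ _)).trans hk2
    · intro p hp
      rcases Finset.mem_insert.mp hp with rfl | hp
      · exact h2
      · exact (h1.of_dvd (Dvd.dvd.mul_left (Finset.dvd_prod_of_mem _ hp) _)).trans (hk3 p hp)

lemma mVal_prod_pow {p : ℕ} (hp : p.Prime) (T : Finset ℕ) (hT : ∀ q ∈ T, q.Prime) (f : ℕ → ℕ) :
    (∏ q ∈ T, (q : ℤ) ^ f q) ≠ 0 ∧
    mVal p (∏ q ∈ T, (q : ℤ) ^ f q) = if p ∈ T then (f p : ZMod 2) else 0 := by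
  classical
  have hpow : ∀ q : ℕ, q.Prime → ∀ k : ℕ, mVal p ((q : ℤ) ^ k) = if p = q then (k : ZMod 2) else 0 := by
    intro q hq k
    have hq0 : (q : ℤ) ≠ 0 := by exact_mod_cast hq.ne_zero
    induction k with
    | zero => simp [mVal]
    | succ k ih => 
      rw [pow_succ, mVal_mul hp (pow_ne_zero _ hq0) hq0, ih, mVal_prime hp hq]
      split_ifs <;> simp
  induction T using Finset.induction_on with
  | empty => simp [mVal]
  | insert q T hq ih =>
    obtain ⟨h1, h2⟩ := ih (fun r hr => hT r (Finset.mem_insert_of_mem hr))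
    have hqp := hT q (Finset.mem_insert_self _ _)
    have hq0 : (q : ℤ) ^ f q ≠ 0 := pow_ne_zero _ (by exact_mod_cast hqp.ne_zero)
    rw [Finset.prod_insert hq]
    refine ⟨mul_ne_zero hq0 h1, ?_⟩
    rw [mVal_mul hp hq0 h1, h2, hpow q hqp]
    by_cases h : p = q
    · subst h; simp [hq]
    · simp [h]

/-- approximation by a number with one extra prime, using Dirichlet's theorem -/
lemma approx (T : Finset ℕ) (hT : ∀ p ∈ T, p.Prime ∧ p ≠ 2) (t : ℕ → ZMod 2 × ZMod 2)
    (t2 : ZMod 2 × ZMod 2 × ZMod 2) (s : ZMod 2) :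
    ∃ (c : ℤ) (l : ℕ), c ≠ 0 ∧ l.Prime ∧ l ≠ 2 ∧ l ∉ T ∧ (∀ p ∈ T, clsOdd p c = t p) ∧
      clsTwo c = t2 ∧ mSg c = s ∧ mVal l c = 1 ∧
      (∀ p : ℕ, p.Prime → p ≠ 2 → (p : ℤ) ∣ c → p ∈ T ∨ p = l) := by
  classical
  set P : ℤ := ∏ q ∈ T, (q : ℤ) ^ (t q).1.val with hP
  have hT' : ∀ p ∈ T, p.Prime := fun p hp => (hT p hp).1
  have hP0 : P ≠ 0 := (mVal_prod_pow Nat.prime_two T hT' _).1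
  have hPv : ∀ p : ℕ, p.Prime → mVal p P = if p ∈ T then (t p).1 else 0 := by
    intro p hp
    rw [(mVal_prod_pow hp T hT' _).2]
    simp
  have h20 : ((2 : ℕ) : ℤ) ^ t2.1.val ≠ 0 := by positivity
  set m : ℤ := (-1) ^ s.val * (((2 : ℕ) : ℤ) ^ t2.1.val * P) with hm
  have hs0 : ((-1) ^ s.val : ℤ) ≠ 0 := by positivity
  have hm0 : m ≠ 0 := mul_ne_zero hs0 (mul_ne_zero h20 hP0)
  have hPpos : 0 < P := Finset.prod_pos (fun q hq => by
    have := (hT' q hq).pos; positivity)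
  have hmsg : mSg m = s := by
    have h1 : 0 < ((2 : ℕ) : ℤ) ^ t2.1.val * P := mul_pos (by positivity) hPpos
    rw [hm, mSg_mul hs0 h1.ne']
    have h3 : mSg (((2 : ℕ) : ℤ) ^ t2.1.val * P) = 0 := by rw [mSg, if_neg (not_lt.mpr h1.le)]
    rw [h3, add_zero]
    clear * -
    revert s; decide
  have hneg : ∀ p : ℕ, p.Prime → mVal p ((-1) ^ s.val : ℤ) = 0 := by
    intro p hp
    apply mVal_of_not_dvd hp
    intro h
    have h4 := (Nat.prime_iff_prime_int.mp hp).dvd_of_dvd_pow h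
    exact not_dvd_neg_one hp h4
  have h2pow : ∀ p : ℕ, p.Prime → p ≠ 2 → mVal p (((2 : ℕ) : ℤ) ^ t2.1.val) = 0 := by
    intro p hp h
    apply mVal_of_not_dvd hp
    intro h'
    exact not_dvd_prime hp Nat.prime_two h ((Nat.prime_iff_prime_int.mp hp).dvd_of_dvd_pow h')
  have hmv : ∀ p ∈ T, mVal p m = (t p).1 := by
    intro p hp
    obtain ⟨hpp, hp2⟩ := hT p hp
    rw [hm, mVal_mul hpp hs0 (mul_ne_zero h20 hP0), mVal_mul hpp h20 hP0, hneg p hpp,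
      h2pow p hpp hp2, hPv p hpp, if_pos hp]; simp
  have hmv2 : mVal 2 m = t2.1 := by
    have h2T : 2 ∉ T := fun h => (hT 2 h).2 rfl
    rw [hm, mVal_mul Nat.prime_two hs0 (mul_ne_zero h20 hP0), mVal_mul Nat.prime_two h20 hP0,
      hneg 2 Nat.prime_two, hPv 2 Nat.prime_two, if_neg h2T]
    have h5 := mUp_unique Nat.prime_two (a := ((2 : ℕ) : ℤ) ^ t2.1.val) (k := t2.1.val) (u := 1)
      (by simp) (by norm_num)
    rw [mVal, h5.1]; simp
  choose! r hr1 hr2 using fun (p : ℕ) (hp : p ∈ T) =>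
    exists_res (hT p hp).1 (hT p hp).2 ((t p).2 - mChi p m)
  obtain ⟨r2, hr21, hr22⟩ := exists_res_two (t2.2.1 - mE m) (t2.2.2 - mW m)
  obtain ⟨k, hk1, hk2, hk3⟩ := crt_set T hT r r2 hr1 hr21
  have hN0 : 8 * ∏ p ∈ T, p ≠ 0 := by
    have : ∏ p ∈ T, p ≠ 0 := Finset.prod_ne_zero_iff.mpr (fun p hp => (hT' p hp).ne_zero)
    positivity
  obtain ⟨l, hl1, hl2, hl3⟩ := Nat.forall_exists_prime_gt_and_modEq
    (m.natAbs + 2 + ∑ p ∈ T, p) hN0 hk1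
  have hl0 : (l : ℤ) ≠ 0 := by exact_mod_cast hl2.ne_zero
  have hlm : ¬ (l : ℤ) ∣ m := by
    intro h
    have := Nat.le_of_dvd (by positivity) (Int.natCast_dvd.mp h)
    omega
  refine ⟨m * l, l, mul_ne_zero hm0 hl0, hl2, by omega, ?_, ?_, ?_, ?_, ?_, ?_⟩
  · intro hlT
    have := Finset.single_le_sum (f := fun p : ℕ => p) (fun _ _ => Nat.zero_le _) hlT
    omega
  · intro p hp
    rw [clsOdd_mul (hT' p hp) hm0 hl0, hr2 p hp l ((hl3.of_dvd
      (Dvd.dvd.mul_left (Finset.dvd_prod_of_mem _ hp) _)).trans (hk3 p hp)), clsOdd, hmv p hp]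
    ext <;> simp
  · rw [clsTwo_mul hm0 hl0, hr22 l ((hl3.of_dvd (dvd_mul_right _ _)).trans hk2), clsTwo, hmv2]
    ext <;> simp
  · rw [mSg_mul hm0 hl0, hmsg, mSg_nat, add_zero]
  · rw [mVal_mul hl2 hm0 hl0, mVal_of_not_dvd hl2 hlm, mVal_self hl2, zero_add]
  · intro p hp hp2 hpd
    have hpp := Nat.prime_iff_prime_int.mp hp
    rcases hpp.dvd_or_dvd hpd with h | h
    · left
      rcases hpp.dvd_or_dvd h with h | h
      · exact absurd (hpp.dvd_of_dvd_pow h) (not_dvd_neg_one hp)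
      rcases hpp.dvd_or_dvd h with h | h
      · exact absurd (hpp.dvd_of_dvd_pow h) (not_dvd_prime hp Nat.prime_two hp2)
      obtain ⟨q, hq, hqd⟩ := (Prime.dvd_finset_prod_iff hpp _).mp h
      have := hpp.dvd_of_dvd_pow hqd
      by_contra hpT
      exact not_dvd_prime hp (hT' q hq) (fun e => hpT (e ▸ hq)) this
    · right
      by_contra hne
      exact not_dvd_prime hp hl2 hne h

lemma ternary {T : Finset ℕ} (hT : ∀ p ∈ T, p.Prime ∧ p ≠ 2) {a b : ℤ} (ha : a ≠ 0) (hb : b ≠ 0)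
    {l : ℕ} (hl : l.Prime) (hl2 : l ≠ 2) (hlT : l ∉ T)
    (hTa : ∀ p : ℕ, p.Prime → p ≠ 2 → (p : ℤ) ∣ a → p ∈ T ∨ p = l)
    (hTb : ∀ p : ℕ, p.Prime → p ≠ 2 → (p : ℤ) ∣ b → p ∈ T ∨ p = l)
    (hH : ∀ p ∈ T, mH p a b = 0) (h2 : mH2 a b = 0) (hi : mHinf a b = 0) : mIso a b := by
  classical
  have hG := mG_eq_zero (T := insert l T) (fun p hp => by
    rcases Finset.mem_insert.mp hp with rfl | hp
    · exact ⟨hl, hl2⟩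
    · exact hT p hp) ha hb
    (fun p hp hp2 hd => by rw [Finset.mem_insert]; exact (hTa p hp hp2 hd).symm)
    (fun p hp hp2 hd => by rw [Finset.mem_insert]; exact (hTb p hp hp2 hd).symm)
  rw [mG, h2, hi, Finset.sum_insert hlT, Finset.sum_eq_zero hH] at hG
  simp only [add_zero] at hG
  refine legendre_descent _ a b le_rfl ha hb ?_ ?_
  · intro p hp hp2
    by_cases h1 : p = l
    · rw [h1]; exact hG
    by_cases h3 : p ∈ T
    · exact hH p h3
    have e1 : ¬ (p : ℤ) ∣ a := fun h => by have := hTa p hp hp2 h; tauto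
    have e2 : ¬ (p : ℤ) ∣ b := fun h => by have := hTb p hp hp2 h; tauto
    simp [mH, mVal_of_not_dvd hp e1, mVal_of_not_dvd hp e2]
  · by_contra! h
    have h1 : a < 0 := lt_of_le_of_ne h.1 ha
    have h3 : b < 0 := lt_of_le_of_ne h.2 hb
    simp [mHinf, mSg, h1, h3] at hi

lemma combine (a1 a2 a3 a4 a5 c d : ℤ) (h5 : a5 ≠ 0) (hc0 : c ≠ 0) (hd0 : d ≠ 0)
    (F1 : mIso (a1 * c) (a2 * c)) (F2 : mIso (a3 * d) (a4 * d))
    (F3 : mIso ((-1) * a5 * c) ((-1) * a5 * d)) :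
    ∃ x1 x2 x3 x4 x5 : ℤ, (x1 ≠ 0 ∨ x2 ≠ 0 ∨ x3 ≠ 0 ∨ x4 ≠ 0 ∨ x5 ≠ 0) ∧
      a1 * x1 ^ 2 + a2 * x2 ^ 2 + a3 * x3 ^ 2 + a4 * x4 ^ 2 + a5 * x5 ^ 2 = 0 := by
  obtain ⟨x1, x2, z1, n1, q1⟩ := F1
  obtain ⟨x3, x4, z2, n2, q2⟩ := F2
  obtain ⟨w1, w2, w3, n3, q3⟩ := F3
  -- c (a1 x1² + a2 x2²) = z1²
  by_cases hz1 : z1 = 0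
  · subst hz1
    refine ⟨x1, x2, 0, 0, 0, by tauto, ?_⟩
    have : c * (a1 * x1 ^ 2 + a2 * x2 ^ 2) = 0 := by linear_combination q1
    have := (mul_eq_zero.mp this).resolve_left hc0
    linear_combination this
  by_cases hz2 : z2 = 0
  · subst hz2
    refine ⟨0, 0, x3, x4, 0, by tauto, ?_⟩
    have : d * (a3 * x3 ^ 2 + a4 * x4 ^ 2) = 0 := by linear_combination q2
    have := (mul_eq_zero.mp this).resolve_left hd0
    linear_combination this
  -- a1 (c x1)² + a2 (c x2)² = c z1²
  have hx12 : x1 ≠ 0 ∨ x2 ≠ 0 := by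
    by_contra! h
    rw [h.1, h.2] at q1
    apply hz1
    have : z1 ^ 2 = 0 := by linear_combination -q1
    exact pow_eq_zero_iff (two_ne_zero) |>.mp this
  have hx34 : x3 ≠ 0 ∨ x4 ≠ 0 := by
    by_contra! h
    rw [h.1, h.2] at q2
    apply hz2
    have : z2 ^ 2 = 0 := by linear_combination -q2
    exact pow_eq_zero_iff (two_ne_zero) |>.mp this
  refine ⟨c * x1 * z2 * (a5 * w1), c * x2 * z2 * (a5 * w1), d * x3 * z1 * (a5 * w2),
    d * x4 * z1 * (a5 * w2), w3 * z1 * z2, ?_, ?_⟩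
  · by_cases hw3 : w3 = 0
    · by_cases hw1 : w1 = 0
      · have hw2 : w2 ≠ 0 := by tauto
        rcases hx34 with h | h
        · right; right; left; positivity
        · right; right; right; left; positivity
      · rcases hx12 with h | h
        · left; positivity
        · right; left; positivity
    · right; right; right; right; positivity
  · linear_combination c * z2 ^ 2 * a5 ^ 2 * w1 ^ 2 * q1 + d * z1 ^ 2 * a5 ^ 2 * w2 ^ 2 * q2 
      - a5 * z1 ^ 2 * z2 ^ 2 * q3

set_option maxHeartbeats 1000000 in
theorem diag5 (a1 a2 a3 a4 a5 : ℤ) (h1 : a1 ≠ 0) (h2 : a2 ≠ 0) (h3 : a3 ≠ 0) (h4 : a4 ≠ 0)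
    (h5 : a5 ≠ 0)
    (hs : ¬ (mSg a1 = mSg a2 ∧ mSg a2 = mSg a3 ∧ mSg a3 = mSg a4 ∧ mSg a4 = mSg a5)) :
    ∃ x1 x2 x3 x4 x5 : ℤ, (x1 ≠ 0 ∨ x2 ≠ 0 ∨ x3 ≠ 0 ∨ x4 ≠ 0 ∨ x5 ≠ 0) ∧
      a1 * x1 ^ 2 + a2 * x2 ^ 2 + a3 * x3 ^ 2 + a4 * x4 ^ 2 + a5 * x5 ^ 2 = 0 := by
  classical
  set A : ℤ := a1 * a2 * a3 * a4 * a5 with hA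
  have hA0 : A ≠ 0 := by
    rw [hA]; exact mul_ne_zero (mul_ne_zero (mul_ne_zero (mul_ne_zero h1 h2) h3) h4) h5
  set T : Finset ℕ := A.natAbs.primeFactors.filter (fun p => p ≠ 2) with hTdef
  have hT : ∀ p ∈ T, p.Prime ∧ p ≠ 2 := by
    intro p hp
    rw [hTdef, Finset.mem_filter] at hp
    exact ⟨Nat.prime_of_mem_primeFactors hp.1, hp.2⟩
  have hTA : ∀ p : ℕ, p.Prime → p ≠ 2 → (p : ℤ) ∣ A → p ∈ T := by
    intro p hp hp2 hd
    rw [hTdef, Finset.mem_filter, Nat.mem_primeFactors]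
    exact ⟨⟨hp, Int.natCast_dvd.mp hd, by simpa using hA0⟩, hp2⟩
  have d1 : a1 ∣ A := ⟨a2 * a3 * a4 * a5, by rw [hA]; ring⟩
  have d2 : a2 ∣ A := ⟨a1 * a3 * a4 * a5, by rw [hA]; ring⟩
  have d3 : a3 ∣ A := ⟨a1 * a2 * a4 * a5, by rw [hA]; ring⟩
  have d4 : a4 ∣ A := ⟨a1 * a2 * a3 * a5, by rw [hA]; ring⟩
  have d5 : a5 ∣ A := ⟨a1 * a2 * a3 * a4, by rw [hA]; ring⟩
  have hn : (-1 : ℤ) ≠ 0 := by norm_num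
  have h5n : (-1) * a5 ≠ 0 := mul_ne_zero hn h5
  have d5' : (-1) * a5 ∣ A := by rw [neg_one_mul, neg_dvd]; exact d5
  choose tc td hl1 hl2 hl3 using fun p : ℕ => local_odd (mChi p (-1)) (clsOdd p a1) (clsOdd p a2)
    (clsOdd p a3) (clsOdd p a4) (clsOdd p a5)
  obtain ⟨c2, d2', hc2, hd2, hcd2⟩ := local_two (clsTwo a1) (clsTwo a2) (clsTwo a3) (clsTwo a4)
    (clsTwo a5)
  obtain ⟨ci, di, hci, hdi, hcdi⟩ := local_inf _ _ _ _ _ hs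
  obtain ⟨c, l, hc0, hlp, hl2', hlT, hcT, hcTwo, hcS, hcl, hcd⟩ := approx T hT tc c2 ci
  have hT' : ∀ p ∈ insert l T, p.Prime ∧ p ≠ 2 := by
    intro p hp
    rcases Finset.mem_insert.mp hp with rfl | hp
    · exact ⟨hlp, hl2'⟩
    · exact hT p hp
  obtain ⟨d, k, hd0, hkp, hk2', hkT, hdT, hdTwo, hdS, hdk, hdd⟩ := approx (insert l T) hT'
    (fun p => if p = l then (0, mChi l (-1 * a5)) else td p) d2' di
  have hdT1 : ∀ p ∈ T, clsOdd p d = td p := by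
    intro p hp
    rw [hdT p (Finset.mem_insert_of_mem hp), if_neg]
    rintro rfl; exact hlT hp
  have hdl : clsOdd l d = (0, mChi l (-1 * a5)) := by
    rw [hdT l (Finset.mem_insert_self _ _), if_pos rfl]
  have hlA : ∀ x : ℤ, x ∣ A → ¬ (l : ℤ) ∣ x := fun x hx h => hlT (hTA l hlp hl2' (h.trans hx))
  have hnegO : ∀ p : ℕ, p.Prime → clsOdd p (-1) = (0, mChi p (-1)) := by
    intro p hp; rw [clsOdd, mVal_neg_one hp]
  have hnegT : clsTwo (-1) = (0, 1, 0) := by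
    rw [clsTwo, mVal_neg_one Nat.prime_two, mE_neg_one, mW_neg_one]
  have dvc : ∀ x : ℤ, x ∣ A → ∀ p : ℕ, p.Prime → p ≠ 2 → (p : ℤ) ∣ x * c → p ∈ T ∨ p = l := by
    intro x hx p hp hp2 h
    rcases (Nat.prime_iff_prime_int.mp hp).dvd_or_dvd h with h | h
    · exact Or.inl (hTA p hp hp2 (h.trans hx))
    · exact hcd p hp hp2 h
  have dvd' : ∀ x : ℤ, x ∣ A → ∀ p : ℕ, p.Prime → p ≠ 2 → (p : ℤ) ∣ x * d →
      p ∈ insert l T ∨ p = k := by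
    intro x hx p hp hp2 h
    rcases (Nat.prime_iff_prime_int.mp hp).dvd_or_dvd h with h | h
    · exact Or.inl (Finset.mem_insert_of_mem (hTA p hp hp2 (h.trans hx)))
    · exact hdd p hp hp2 h
  have F1 : mIso (a1 * c) (a2 * c) := by
    refine ternary hT (mul_ne_zero h1 hc0) (mul_ne_zero h2 hc0) hlp hl2' hlT (dvc a1 d1) (dvc a2 d2)
      ?_ ?_ ?_
    · intro p hp
      have hpp := (hT p hp).1
      rw [mH_eq, clsOdd_mul hpp h1 hc0, clsOdd_mul hpp h2 hc0, hcT p hp]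
      exact hl1 p
    · rw [mH2_eq, clsTwo_mul h1 hc0, clsTwo_mul h2 hc0, hcTwo]; exact hc2
    · rw [mHinf, mSg_mul h1 hc0, mSg_mul h2 hc0, hcS]; exact hci
  have F2 : mIso (a3 * d) (a4 * d) := by
    refine ternary hT' (mul_ne_zero h3 hd0) (mul_ne_zero h4 hd0) hkp hk2' hkT (dvd' a3 d3)
      (dvd' a4 d4) ?_ ?_ ?_
    · intro p hp
      rcases Finset.mem_insert.mp hp with rfl | hp
      · have e1 : mVal p d = 0 := congrArg Prod.fst hdl
        have e3 := mVal_of_not_dvd hlp (hlA a3 d3)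
        have e4 := mVal_of_not_dvd hlp (hlA a4 d4)
        simp [mH, mVal_mul hlp h3 hd0, mVal_mul hlp h4 hd0, e1, e3, e4]
      have hpp := (hT p hp).1
      rw [mH_eq, clsOdd_mul hpp h3 hd0, clsOdd_mul hpp h4 hd0, hdT1 p hp]
      exact hl2 p
    · rw [mH2_eq, clsTwo_mul h3 hd0, clsTwo_mul h4 hd0, hdTwo]; exact hd2
    · rw [mHinf, mSg_mul h3 hd0, mSg_mul h4 hd0, hdS]; exact hdi
  have F3 : mIso ((-1) * a5 * c) ((-1) * a5 * d) := by
    refine ternary hT' (mul_ne_zero h5n hc0) (mul_ne_zero h5n hd0) hkp hk2' hkT ?_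
      (dvd' _ d5') ?_ ?_ ?_
    · intro p hp hp2 h
      left
      rw [Finset.mem_insert]
      exact (dvc _ d5' p hp hp2 h).symm
    · intro p hp
      rcases Finset.mem_insert.mp hp with rfl | hp
      · have e1 : mVal p d = 0 := congrArg Prod.fst hdl
        have e2 : mChi p d = mChi p (-1 * a5) := congrArg Prod.snd hdl
        have e3 := mVal_of_not_dvd hlp (hlA _ d5')
        rw [mH, mVal_mul hlp h5n hc0, mVal_mul hlp h5n hd0, mChi_mul hlp h5n hd0, e1, e2, e3,
          z2_add_self (mChi p (-1 * a5))]
        simp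
      have hpp := (hT p hp).1
      rw [mH_eq, clsOdd_mul hpp h5n hc0, clsOdd_mul hpp h5n hd0, clsOdd_mul hpp hn h5,
        hnegO p hpp, hdT1 p hp, hcT p hp]
      exact hl3 p
    · rw [mH2_eq, clsTwo_mul h5n hc0, clsTwo_mul h5n hd0, clsTwo_mul hn h5, hcTwo, hdTwo, hnegT]
      exact hcd2
    · rw [mHinf, mSg_mul h5n hc0, mSg_mul h5n hd0, mSg_mul hn h5, hcS, hdS, mSg_neg_one]
      exact hcdi
  exact combine a1 a2 a3 a4 a5 c d h5 hc0 hd0 F1 F2 F3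

lemma diag5Q (w : Fin 5 → ℚ) (h0 : ∀ k, w k ≠ 0) (hp : ∃ i, 0 < w i) (hn : ∃ j, w j < 0) :
    ∃ y : Fin 5 → ℚ, y ≠ 0 ∧ ∑ k, w k * y k ^ 2 = 0 := by
  set a : Fin 5 → ℤ := fun k => (w k).num * (w k).den with ha
  have haw : ∀ k, (a k : ℚ) = w k * (w k).den ^ 2 := by
    intro k
    have : (w k).den ≠ 0 := (w k).den_nz
    have h2 : ((w k).num : ℚ) = w k * (w k).den := (Rat.mul_den_eq_num (w k)).symm
    simp only [ha]; push_cast; rw [h2]; ring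
  have ha0 : ∀ k, a k ≠ 0 := by
    intro k
    simp only [ha]
    exact mul_ne_zero (by simpa using h0 k) (by exact_mod_cast (w k).den_nz)
  have hsg : ∀ k, mSg (a k) = if w k < 0 then 1 else 0 := by
    intro k
    have hd : (0 : ℤ) < (w k).den := by exact_mod_cast (w k).den_pos
    have : a k < 0 ↔ w k < 0 := by
      rw [← Rat.num_neg]
      simp only [ha]
      constructor
      · intro h; by_contra! h'; nlinarith [mul_nonneg h' hd.le]
      · intro h; exact mul_neg_of_neg_of_pos h hd
    simp only [mSg, this]
  obtain ⟨i, hi⟩ := hp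
  obtain ⟨j, hj⟩ := hn
  obtain ⟨x1, x2, x3, x4, x5, hx, hq⟩ := diag5 (a 0) (a 1) (a 2) (a 3) (a 4) (ha0 _) (ha0 _) (ha0 _)
    (ha0 _) (ha0 _) (by
      rintro ⟨e1, e2, e3, e4⟩
      have hall : ∀ k, mSg (a k) = mSg (a 0) := by
        intro k
        fin_cases k
        · rfl
        · exact e1.symm
        · exact (e1.trans e2).symm
        · exact (e1.trans (e2.trans e3)).symm
        · exact (e1.trans (e2.trans (e3.trans e4))).symm
      have := (hall i).trans (hall j).symm
      rw [hsg, hsg, if_pos hj, if_neg (not_lt.mpr hi.le)] at this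
      exact absurd this (by decide))
  have hd : ∀ k, ((w k).den : ℚ) ≠ 0 := fun k => by exact_mod_cast (w k).den_nz
  refine ⟨![(w 0).den * x1, (w 1).den * x2, (w 2).den * x3, (w 3).den * x4, (w 4).den * x5], ?_, ?_⟩
  · intro h
    have g0 := congrFun h 0
    have g1 := congrFun h 1
    have g2 := congrFun h 2
    have g3 := congrFun h 3
    have g4 := congrFun h 4
    simp at g0 g1 g2 g3 g4
    tauto
  · have hq' : ((a 0 * x1 ^ 2 + a 1 * x2 ^ 2 + a 2 * x3 ^ 2 + a 3 * x4 ^ 2 + a 4 * x5 ^ 2 : ℤ) : ℚ) = 0 := by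
      rw [hq]; simp
    push_cast at hq'
    rw [haw, haw, haw, haw, haw] at hq'
    simp [Fin.sum_univ_five]
    linear_combination hq'

lemma bilin_ortho_sum {n m : ℕ} (B : LinearMap.BilinForm ℚ (Fin n → ℚ)) (u : Fin m → (Fin n → ℚ))
    (hu : ∀ i j, i ≠ j → B (u i) (u j) = 0) (y : Fin m → ℚ) :
    B (∑ i, y i • u i) (∑ i, y i • u i) = ∑ i, B (u i) (u i) * y i ^ 2 := by
  simp only [map_sum, LinearMap.sum_apply, map_smul, LinearMap.smul_apply, smul_eq_mul]
  refine Finset.sum_congr rfl (fun i _ => ?_)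
  rw [Finset.sum_eq_single i]
  · ring
  · intro j _ hj
    rw [hu _ _ hj]; ring
  · simp

open Matrix in
lemma exists_rat_pos {n : ℕ} (M : Matrix (Fin n) (Fin n) ℤ)
    (hpos : ∃ u : Fin n → ℝ, 0 < u ⬝ᵥ ((M.map (Int.cast : ℤ → ℝ)) *ᵥ u)) :
    ∃ x : Fin n → ℚ, 0 < x ⬝ᵥ ((M.map (Int.cast : ℤ → ℚ)) *ᵥ x) := by
  have hc : Continuous (fun u : Fin n → ℝ => u ⬝ᵥ ((M.map (Int.cast : ℤ → ℝ)) *ᵥ u)) := by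
    simp only [dotProduct, mulVec]; fun_prop
  have ho : IsOpen {u : Fin n → ℝ | 0 < u ⬝ᵥ ((M.map (Int.cast : ℤ → ℝ)) *ᵥ u)} :=
    isOpen_lt continuous_const hc
  have hd : DenseRange (Pi.map (fun _ : Fin n => ((↑) : ℚ → ℝ))) :=
    DenseRange.piMap (fun _ => Rat.denseRange_cast)
  obtain ⟨x, hx⟩ := hd.exists_mem_open ho hpos
  refine ⟨x, ?_⟩
  simp only [Set.mem_setOf_eq, dotProduct, mulVec, Pi.map_apply, map_apply] at hx ⊢
  have : (0 : ℝ) < ((∑ i, x i * ∑ j, (M i j : ℚ) * x j : ℚ) : ℝ) := by push_cast; exact hx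
  exact_mod_cast this

open Matrix in
lemma int_of_rat {n : ℕ} (M : Matrix (Fin n) (Fin n) ℤ) (X : Fin n → ℚ) (hX : X ≠ 0)
    (h : X ⬝ᵥ ((M.map (Int.cast : ℤ → ℚ)) *ᵥ X) = 0) :
    ∃ x : Fin n → ℤ, x ≠ 0 ∧ x ⬝ᵥ (M *ᵥ x) = 0 := by
  obtain ⟨⟨N, hN⟩, hb⟩ := IsLocalization.exist_integer_multiples_of_finite
    (nonZeroDivisors ℤ) (S := ℚ) X
  have hN0 : N ≠ 0 := nonZeroDivisors.ne_zero hN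
  choose z hz using hb
  have hz' : ∀ i, (z i : ℚ) = N * X i := by
    intro i; have := hz i; simpa using this
  refine ⟨z, ?_, ?_⟩
  · rintro rfl
    apply hX
    funext i
    have := hz' i
    simp at this
    exact this.resolve_left hN0
  · have : ((z ⬝ᵥ (M *ᵥ z) : ℤ) : ℚ) = N ^ 2 * (X ⬝ᵥ ((M.map (Int.cast : ℤ → ℚ)) *ᵥ X)) := by
      simp only [dotProduct, mulVec, map_apply]
      push_cast
      simp only [hz', Finset.mul_sum]
      refine Finset.sum_congr rfl (fun i _ => Finset.sum_congr rfl (fun j _ => ?_))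
      ring
    rw [h, mul_zero] at this
    exact_mod_cast this

open Matrix in
/-- Meyer: a nondegenerate indefinite integral quadratic form in n ≥ 5
variables represents zero nontrivially over ℤ. -/
theorem meyer_theorem (n : ℕ) (hn : 5 ≤ n) (M : Matrix (Fin n) (Fin n) ℤ)
    (hsymm : M.IsSymm) (hnd : M.det ≠ 0)
    (hpos : ∃ u : Fin n → ℝ, 0 < u ⬝ᵥ ((M.map (Int.cast : ℤ → ℝ)) *ᵥ u))
    (hneg : ∃ v : Fin n → ℝ, v ⬝ᵥ ((M.map (Int.cast : ℤ → ℝ)) *ᵥ v) < 0) :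
    ∃ x : Fin n → ℤ, x ≠ 0 ∧ x ⬝ᵥ (M *ᵥ x) = 0 := by
  have hp := exists_rat_pos M hpos
  have hneg' : ∃ x : Fin n → ℚ, x ⬝ᵥ ((M.map (Int.cast : ℤ → ℚ)) *ᵥ x) < 0 := by
    obtain ⟨x, hx⟩ := exists_rat_pos (-M) (by
      obtain ⟨v, hv⟩ := hneg
      refine ⟨v, ?_⟩
      have e : (-M).map (Int.cast : ℤ → ℝ) = - M.map (Int.cast : ℤ → ℝ) := by ext; simp
      rw [e, neg_mulVec, dotProduct_neg]; linarith)
    refine ⟨x, ?_⟩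
    have e : (-M).map (Int.cast : ℤ → ℚ) = - M.map (Int.cast : ℤ → ℚ) := by ext; simp
    rw [e, neg_mulVec, dotProduct_neg] at hx; linarith
  set B : LinearMap.BilinForm ℚ (Fin n → ℚ) := (M.map (Int.cast : ℤ → ℚ)).toBilin' with hB
  have hBa : ∀ x, B x x = x ⬝ᵥ ((M.map (Int.cast : ℤ → ℚ)) *ᵥ x) := fun x => by
    rw [hB, Matrix.toBilin'_apply']
  have hBs : B.IsSymm := by
    rw [hB, Matrix.isSymm_toBilin'_iff_isSymm]; exact hsymm.map _
  obtain ⟨v, hv⟩ : ∃ v : Module.Basis (Fin n) ℚ (Fin n → ℚ), B.IsOrthoᵢ v := by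
    have hBs2 : LinearMap.IsSymm B := ⟨fun x y => hBs.eq x y⟩
    have := LinearMap.BilinForm.exists_orthogonal_basis hBs2
    rwa [Module.finrank_fin_fun] at this
  have hvo : ∀ i j, i ≠ j → B (v i) (v j) = 0 := fun i j hij => hv hij
  by_cases hz : ∃ i, B (v i) (v i) = 0
  · obtain ⟨i, hi⟩ := hz
    exact int_of_rat M (v i) (v.ne_zero i) (by rw [← hBa, hi])
  push Not at hz
  have hx : ∀ x : Fin n → ℚ, x ⬝ᵥ ((M.map (Int.cast : ℤ → ℚ)) *ᵥ x) =
      ∑ i, B (v i) (v i) * v.repr x i ^ 2 := by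
    intro x
    rw [← hBa, ← bilin_ortho_sum B v hvo, v.sum_repr]
  obtain ⟨i, hi⟩ : ∃ i, 0 < B (v i) (v i) := by
    by_contra! h
    obtain ⟨x, hx'⟩ := hp
    rw [hx] at hx'
    exact absurd hx' (not_lt.mpr (Finset.sum_nonpos (fun i _ =>
      mul_nonpos_of_nonpos_of_nonneg (h i) (sq_nonneg _))))
  obtain ⟨j, hj⟩ : ∃ j, B (v j) (v j) < 0 := by
    by_contra! h
    obtain ⟨x, hx'⟩ := hneg'
    rw [hx] at hx'
    exact absurd hx' (not_lt.mpr (Finset.sum_nonneg (fun i _ =>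
      mul_nonneg (h i) (sq_nonneg _))))
  obtain ⟨s, hs, hs5⟩ := Finset.exists_superset_card_eq (s := ({i, j} : Finset (Fin n))) (n := 5)
    ((Finset.card_le_two).trans (by norm_num)) (by simpa using hn)
  set f := s.orderEmbOfFin hs5 with hf
  have hfs : ∀ k ∈ s, ∃ m, f m = k := by
    intro k hk
    have := Finset.range_orderEmbOfFin s hs5
    have hk' : k ∈ (s : Set (Fin n)) := hk
    rw [← this] at hk'
    exact hk'
  obtain ⟨i', hi'⟩ := hfs i (hs (by simp))
  obtain ⟨j', hj'⟩ := hfs j (hs (by simp))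
  obtain ⟨y, hy0, hy⟩ := diag5Q (fun k => B (v (f k)) (v (f k))) (fun k => hz _)
    ⟨i', by simp only [hi']; exact hi⟩ ⟨j', by simp only [hj']; exact hj⟩
  refine int_of_rat M (∑ k, y k • v (f k)) ?_ ?_
  · intro h
    apply hy0
    have hli : LinearIndependent ℚ (fun k => v (f k)) := v.linearIndependent.comp f f.injective
    funext k
    exact Fintype.linearIndependent_iff.mp hli y h k
  · rw [← hBa, bilin_ortho_sum B (fun k => v (f k)) (fun a b hab => hvo _ _ (fun h => hab (f.injective h)))]
    exact hy
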